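/- Assume that the family of random variables ζ_n(ω) := (n/T)^{1/2} ∫₀^T |μ_s(ω) − μ_{⌊sn/T⌋ T/n}(ω)| ds, n ≥ 1, is bounded in probability. Then the family of random variables ε^{−1/3} · sup_{t ∈ [0, T]} |X^ε_t(ω) − X̄_t(ω)|, ε ∈ (0, 1], is bounded in probability. -/

import Mathlib

open intervalIntegral Filter MeasureTheory

/-- `Y : ℝ → ℝ` is a continuous solution on `[0, T]` of the (Doss–Sussmann transformed)
integral equation
`Y t = H (0, x₀) + ∫₀^t (∂H/∂x) (m s, F (m s, Y s)) · b (F (m s, Y s), s / ε) ds`. -/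
def SolvesAveragingODE (F H : ℝ × ℝ → ℝ) (b : ℝ × ℝ → ℝ) (m : ℝ → ℝ)
    (T x₀ ε : ℝ) (Y : ℝ → ℝ) : Prop :=
  ContinuousOn Y (Set.Icc 0 T) ∧
  ∀ t ∈ Set.Icc (0:ℝ) T,
    Y t = H (0, x₀) + ∫ s in (0:ℝ)..t,
      deriv (fun y : ℝ => H (m s, y)) (F (m s, Y s)) * b (F (m s, Y s), s / ε)

/-- A family of random variables `ξ i` is bounded in probability if
`sup_i P (|ξ i| ≥ c) → 0` as `c → ∞`. -/
def BoundedInProbability {Ω : Type*} {ι : Type*} [MeasurableSpace Ω]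
    (P : Measure Ω) (ξ : ι → Ω → ℝ) : Prop :=
  Tendsto (fun c : ℝ => ⨆ i : ι, P {ω | c ≤ |ξ i ω|}) atTop (nhds 0)

section Flow

theorem abs_sub_sub_deriv_mul_sub_le {σ : ℝ → ℝ} (hσ : ContDiff ℝ 2 σ) {C₂ : ℝ}
    (hC₂ : ∀ x, |deriv (deriv σ) x| ≤ C₂) (a z : ℝ) :
    |σ z - σ a - deriv σ a * (z - a)| ≤ C₂ * |z - a| * |z - a| := by
  have hC₂0 : 0 ≤ C₂ := (abs_nonneg _).trans (hC₂ 0)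
  have hd : Differentiable ℝ σ := hσ.differentiable (by norm_num)
  have hd' : Differentiable ℝ (deriv σ) :=
    (((contDiff_succ_iff_deriv (n := 1)).1 (by simpa using! hσ)).2.2).differentiable (by norm_num)
  have key := (convex_uIcc a z).norm_image_sub_le_of_norm_hasDerivWithin_le
    (f := fun w => σ w - deriv σ a * w) (f' := fun w => deriv σ w - deriv σ a) (C := C₂ * |z - a|)
    (fun w _ => (((hd w).hasDerivAt.sub
      (by simpa using (hasDerivAt_id w).const_mul (deriv σ a))).hasDerivWithinAt))
    (fun w hw => by
      have h1 := convex_univ.norm_image_sub_le_of_norm_deriv_le (f := deriv σ) (C := C₂)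
        (fun u _ => hd' u) (fun u _ => hC₂ u) (Set.mem_univ a) (Set.mem_univ w)
      have h2 : |w - a| ≤ |z - a| := Set.abs_sub_left_of_mem_uIcc hw
      exact h1.trans (mul_le_mul_of_nonneg_left h2 hC₂0))
    Set.left_mem_uIcc Set.right_mem_uIcc
  simp only [Real.norm_eq_abs] at key
  convert key using 2
  ring

theorem flow_sub_eq_mul_exp {σ : ℝ → ℝ} (hσ : Continuous σ) {F : ℝ × ℝ → ℝ}
    (hF0 : ∀ x : ℝ, F (0, x) = x)
    (hFr : ∀ r x : ℝ, HasDerivAt (fun r' : ℝ => F (r', x)) (σ (F (r, x))) r)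
    (hinj : ∀ r : ℝ, Function.Injective fun x : ℝ => F (r, x)) {x y : ℝ} (hxy : y ≠ x) (r : ℝ) :
    F (r, y) - F (r, x) = (y - x) *
      Real.exp (∫ u in (0:ℝ)..r, (σ (F (u, y)) - σ (F (u, x))) / (F (u, y) - F (u, x))) := by
  have hFc : ∀ z, Continuous fun u => F (u, z) := fun z =>
    continuous_iff_continuousAt.2 fun u => (hFr u z).continuousAt
  have hne : ∀ u, F (u, y) - F (u, x) ≠ 0 := fun u h => hxy (hinj u (sub_eq_zero.1 h))
  set q : ℝ → ℝ := fun u => (σ (F (u, y)) - σ (F (u, x))) / (F (u, y) - F (u, x)) with hq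
  have hqc : Continuous q :=
    ((hσ.comp (hFc y)).sub (hσ.comp (hFc x))).div ((hFc y).sub (hFc x)) hne
  have hder : ∀ u, HasDerivAt
      (fun u => (F (u, y) - F (u, x)) * Real.exp (-∫ v in (0:ℝ)..u, q v)) 0 u := by
    intro u
    have h1 := (hFr u y).sub (hFr u x)
    have h2 := (hqc.integral_hasStrictDerivAt 0 u).hasDerivAt.neg.exp
    convert! h1.mul h2 using 1
    have : q u * (F (u, y) - F (u, x)) = σ (F (u, y)) - σ (F (u, x)) := div_mul_cancel₀ _ (hne u)
    simp only [Pi.sub_apply, Pi.neg_apply]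
    linear_combination -Real.exp (-∫ v in (0:ℝ)..u, q v) * (-this)
  have hconst := is_const_of_deriv_eq_zero (fun u => (hder u).differentiableAt)
    (fun u => (hder u).deriv) r 0
  simp only [integral_same, neg_zero, Real.exp_zero, mul_one, hF0] at hconst
  rw [← hconst, mul_assoc, ← Real.exp_add, neg_add_cancel, Real.exp_zero, mul_one]

theorem abs_flow_sub_le_and_ge {σ : ℝ → ℝ} (hσ : Differentiable ℝ σ) {C₁ : ℝ}
    (hC₁ : ∀ x, |deriv σ x| ≤ C₁) {F : ℝ × ℝ → ℝ}
    (hF0 : ∀ x : ℝ, F (0, x) = x)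
    (hFr : ∀ r x : ℝ, HasDerivAt (fun r' : ℝ => F (r', x)) (σ (F (r, x))) r)
    (hinj : ∀ r : ℝ, Function.Injective fun x : ℝ => F (r, x)) (r x y : ℝ) :
    |F (r, y) - F (r, x)| ≤ Real.exp (C₁ * |r|) * |y - x| ∧
      |y - x| ≤ Real.exp (C₁ * |r|) * |F (r, y) - F (r, x)| := by
  rcases eq_or_ne y x with rfl | hxy
  · simp
  have hC₁0 : 0 ≤ C₁ := (abs_nonneg _).trans (hC₁ 0)
  rw [flow_sub_eq_mul_exp hσ.continuous hF0 hFr hinj hxy r, abs_mul, Real.abs_exp]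
  set Q := ∫ u in (0:ℝ)..r, (σ (F (u, y)) - σ (F (u, x))) / (F (u, y) - F (u, x)) with hQ
  have hQb : |Q| ≤ C₁ * |r| := by
    have := norm_integral_le_of_norm_le_const (a := 0) (b := r) (C := C₁)
      (f := fun u => (σ (F (u, y)) - σ (F (u, x))) / (F (u, y) - F (u, x))) (fun u _ => by
        rw [norm_div]
        refine div_le_of_le_mul₀ (norm_nonneg _) hC₁0 ?_
        exact convex_univ.norm_image_sub_le_of_norm_deriv_le (f := σ) (C := C₁)
          (fun u _ => hσ u) (fun u _ => hC₁ u) (Set.mem_univ _) (Set.mem_univ _))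
    simpa using this
  have hp := abs_nonneg (y - x)
  constructor
  · rw [mul_comm]
    exact mul_le_mul_of_nonneg_right (Real.exp_le_exp.2 ((le_abs_self _).trans hQb)) hp
  · rw [mul_left_comm, ← Real.exp_add]
    refine le_mul_of_one_le_right hp (Real.one_le_exp ?_)
    linarith [neg_abs_le Q]

theorem hasDerivAt_flow {σ : ℝ → ℝ} (hσ : ContDiff ℝ 2 σ) {C₁ C₂ : ℝ}
    (hC₁ : ∀ x, |deriv σ x| ≤ C₁) (hC₂ : ∀ x, |deriv (deriv σ) x| ≤ C₂) {F : ℝ × ℝ → ℝ}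
    (hF0 : ∀ x : ℝ, F (0, x) = x)
    (hFr : ∀ r x : ℝ, HasDerivAt (fun r' : ℝ => F (r', x)) (σ (F (r, x))) r)
    (hinj : ∀ r : ℝ, Function.Injective fun x : ℝ => F (r, x)) (r x : ℝ) :
    HasDerivAt (fun y => F (r, y)) (Real.exp (∫ u in (0:ℝ)..r, deriv σ (F (u, x)))) x := by
  have hd : Differentiable ℝ σ := hσ.differentiable (by norm_num)
  have hσ'c : Continuous (deriv σ) := hσ.continuous_deriv (by norm_num)
  have hC₁0 : 0 ≤ C₁ := (abs_nonneg _).trans (hC₁ 0)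
  have hC₂0 : 0 ≤ C₂ := (abs_nonneg _).trans (hC₂ 0)
  have hFc : ∀ z, Continuous fun u => F (u, z) := fun z =>
    continuous_iff_continuousAt.2 fun u => (hFr u z).continuousAt
  rw [hasDerivAt_iff_tendsto_slope]
  have hQ : Tendsto (fun y => ∫ u in (0:ℝ)..r,
      (σ (F (u, y)) - σ (F (u, x))) / (F (u, y) - F (u, x))) (nhdsWithin x {x}ᶜ)
      (nhds (∫ u in (0:ℝ)..r, deriv σ (F (u, x)))) := by
    rw [tendsto_iff_norm_sub_tendsto_zero]
    refine squeeze_zero_norm' (a := fun y => C₂ * (Real.exp (C₁ * |r|) * |y - x|) * |r|) ?_ ?_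
    · filter_upwards [self_mem_nhdsWithin] with y hy
      have hne : ∀ u, F (u, y) - F (u, x) ≠ 0 := fun u h => hy (hinj u (sub_eq_zero.1 h))
      have hint : IntervalIntegrable
          (fun u => (σ (F (u, y)) - σ (F (u, x))) / (F (u, y) - F (u, x))) volume 0 r :=
        (((hd.continuous.comp (hFc y)).sub (hd.continuous.comp (hFc x))).div
          ((hFc y).sub (hFc x)) hne).intervalIntegrable _ _
      have hint' : IntervalIntegrable (fun u => deriv σ (F (u, x))) volume 0 r :=
        (hσ'c.comp (hFc x)).intervalIntegrable _ _
      rw [norm_norm, ← intervalIntegral.integral_sub hint hint']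
      have := norm_integral_le_of_norm_le_const (a := 0) (b := r)
        (C := C₂ * (Real.exp (C₁ * |r|) * |y - x|))
        (f := fun u => (σ (F (u, y)) - σ (F (u, x))) / (F (u, y) - F (u, x)) - deriv σ (F (u, x)))
        (fun u hu => by
          have hur : |u| ≤ |r| := by
            simpa using Set.abs_sub_left_of_mem_uIcc (Set.uIoc_subset_uIcc hu)
          have h1 := abs_sub_sub_deriv_mul_sub_le hσ hC₂ (F (u, x)) (F (u, y))
          have h2 := (abs_flow_sub_le_and_ge hd hC₁ hF0 hFr hinj u x y).1
          have h3 : Real.exp (C₁ * |u|) ≤ Real.exp (C₁ * |r|) := by gcongr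
          have h4 : (σ (F (u, y)) - σ (F (u, x))) / (F (u, y) - F (u, x)) - deriv σ (F (u, x)) =
            (σ (F (u, y)) - σ (F (u, x)) - deriv σ (F (u, x)) * (F (u, y) - F (u, x))) /
              (F (u, y) - F (u, x)) := by
            rw [sub_div (σ (F (u, y)) - σ (F (u, x))), mul_div_cancel_right₀ _ (hne u)]
          rw [h4, norm_div, Real.norm_eq_abs, Real.norm_eq_abs,
            div_le_iff₀ (abs_pos.2 (hne u))]
          refine h1.trans (mul_le_mul_of_nonneg_right ?_ (abs_nonneg _))
          refine mul_le_mul_of_nonneg_left (h2.trans ?_) hC₂0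
          exact mul_le_mul_of_nonneg_right h3 (abs_nonneg _))
      simpa using this
    · have : Continuous fun y => C₂ * (Real.exp (C₁ * |r|) * |y - x|) * |r| := by fun_prop
      simpa using (this.tendsto x).mono_left nhdsWithin_le_nhds
  refine ((Real.continuous_exp.tendsto _).comp hQ).congr' ?_
  filter_upwards [self_mem_nhdsWithin] with y hy
  have hyx : y - x ≠ 0 := sub_ne_zero.2 hy
  rw [slope_def_field, flow_sub_eq_mul_exp hd.continuous hF0 hFr hinj hy r,
    mul_div_cancel_left₀ _ hyx]
  rfl

theorem deriv_flow_inverse {σ : ℝ → ℝ} (hσ : ContDiff ℝ 2 σ) {C₁ C₂ : ℝ}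
    (hC₁ : ∀ x, |deriv σ x| ≤ C₁) (hC₂ : ∀ x, |deriv (deriv σ) x| ≤ C₂) {F H : ℝ × ℝ → ℝ}
    (hF0 : ∀ x : ℝ, F (0, x) = x)
    (hFr : ∀ r x : ℝ, HasDerivAt (fun r' : ℝ => F (r', x)) (σ (F (r, x))) r)
    (hH : ∀ r : ℝ, Function.LeftInverse (fun y : ℝ => H (r, y)) (fun x : ℝ => F (r, x)) ∧
      Function.RightInverse (fun y : ℝ => H (r, y)) (fun x : ℝ => F (r, x))) (r x : ℝ) :
    deriv (fun y => H (r, y)) (F (r, x)) =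
      Real.exp (-∫ u in (0:ℝ)..r, deriv σ (F (u, x))) := by
  have hd : Differentiable ℝ σ := hσ.differentiable (by norm_num)
  have hinj : ∀ r : ℝ, Function.Injective fun x : ℝ => F (r, x) := fun r => (hH r).1.injective
  have hHl : H (r, F (r, x)) = x := (hH r).1 x
  have hHr : ∀ y, F (r, H (r, y)) = y := (hH r).2
  have hcont : ContinuousAt (fun y => H (r, y)) (F (r, x)) := by
    refine Continuous.continuousAt (LipschitzWith.continuous
      (K := ⟨Real.exp (C₁ * |r|), (Real.exp_pos _).le⟩) (LipschitzWith.of_dist_le_mul ?_))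
    intro y z
    have := (abs_flow_sub_le_and_ge hd hC₁ hF0 hFr hinj r (H (r, z)) (H (r, y))).2
    rw [hHr, hHr] at this
    exact this
  rw [Real.exp_neg]
  refine (HasDerivAt.of_local_left_inverse (f := fun y => F (r, y)) hcont ?_ (Real.exp_pos _).ne'
    (Eventually.of_forall hHr)).deriv
  rw [hHl]
  exact hasDerivAt_flow hσ hC₁ hC₂ hF0 hFr hinj r x

end Flow

section Averaging

theorem continuousOn_comp_of_lipschitz_box {f : ℝ → ℝ → ℝ → ℝ} {K R Λ : ℝ}
    (hc : ∀ m y, Continuous fun t => f t m y)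
    (hL : ∀ t m m' y y', |m| ≤ K → |m'| ≤ K → |y| ≤ R → |y'| ≤ R →
      |f t m y - f t m' y'| ≤ Λ * (|m - m'| + |y - y'|))
    {S : Set ℝ} {τ m y : ℝ → ℝ} (hτ : Continuous τ) (hm : ContinuousOn m S)
    (hy : ContinuousOn y S) (hmK : ∀ s ∈ S, |m s| ≤ K) (hyR : ∀ s ∈ S, |y s| ≤ R) :
    ContinuousOn (fun s => f (τ s) (m s) (y s)) S := by
  intro s₀ hs₀
  have h1 : Tendsto (fun s => f (τ s) (m s) (y s) - f (τ s) (m s₀) (y s₀))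
      (nhdsWithin s₀ S) (nhds 0) := by
    refine squeeze_zero_norm' (a := fun s => Λ * (|m s - m s₀| + |y s - y s₀|)) ?_ ?_
    · filter_upwards [self_mem_nhdsWithin] with s hs
      exact hL _ _ _ _ _ (hmK s hs) (hmK s₀ hs₀) (hyR s hs) (hyR s₀ hs₀)
    · have h3 : ContinuousWithinAt (fun s => Λ * (|m s - m s₀| + |y s - y s₀|)) S s₀ :=
        ((((hm s₀ hs₀).sub continuousWithinAt_const).abs).add
          (((hy s₀ hs₀).sub continuousWithinAt_const).abs)).const_mul Λ
      simpa [ContinuousWithinAt] using h3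
  have h2 : Tendsto (fun s => f (τ s) (m s₀) (y s₀)) (nhdsWithin s₀ S)
      (nhds (f (τ s₀) (m s₀) (y s₀))) :=
    (((hc (m s₀) (y s₀)).comp hτ).tendsto s₀).mono_left nhdsWithin_le_nhds
  simpa [ContinuousWithinAt] using h1.add h2

theorem intervalIntegrable_abs_sub_comp_floor {m : ℝ → ℝ} {K T c d : ℝ} (hT : 0 ≤ T)
    (hm : ContinuousOn m (Set.Icc 0 T)) (hmK : ∀ s ∈ Set.Icc 0 T, |m s| ≤ K)
    (hfl : ∀ s ∈ Set.Icc 0 T, (⌊s * c / T⌋ : ℝ) * d ∈ Set.Icc 0 T) :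
    IntervalIntegrable (fun s => |m s - m ((⌊s * c / T⌋ : ℝ) * d)|) volume 0 T := by
  have h1 : IntervalIntegrable m volume 0 T := hm.intervalIntegrable_of_Icc hT
  have hmeas : Measurable fun s : ℝ => m ((⌊s * c / T⌋ : ℝ) * d) :=
    (measurable_from_top (f := fun i : ℤ => m ((i : ℝ) * d))).comp
      (Int.measurable_floor.comp (by fun_prop))
  have h2 : IntervalIntegrable (fun s => m ((⌊s * c / T⌋ : ℝ) * d)) volume 0 T := by
    rw [intervalIntegrable_iff_integrableOn_Ioc_of_le hT]
    refine Measure.integrableOn_of_bounded (M := K) (by simp) hmeas.aestronglyMeasurable ?_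
    refine (ae_restrict_iff' measurableSet_Ioc).2 (Eventually.of_forall fun s hs => ?_)
    exact hmK _ (hfl s ⟨hs.1.le, hs.2⟩)
  exact (h1.sub h2).abs

theorem floor_mul_mem_Icc {T : ℝ} (hT : 0 < T) {n : ℕ} (hn : 1 ≤ n) {s : ℝ}
    (hs : s ∈ Set.Icc 0 T) :
    (⌊s * n / T⌋ : ℝ) * (T / n) ∈ Set.Icc 0 s ∧ s - (⌊s * n / T⌋ : ℝ) * (T / n) ≤ T / n := by
  have hn0 : (0:ℝ) < n := by exact_mod_cast hn
  have hδ : 0 < T / n := by positivity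
  have h0 : (0:ℝ) ≤ ⌊s * n / T⌋ := by
    exact_mod_cast Int.floor_nonneg.2 (by have := hs.1; positivity)
  have hs' : s = s * n / T * (T / n) := by field_simp
  have h1 := mul_le_mul_of_nonneg_right (Int.floor_le (s * n / T)) hδ.le
  have h2 := mul_le_mul_of_nonneg_right (Int.lt_floor_add_one (s * n / T)).le hδ.le
  rw [← hs'] at h1 h2
  exact ⟨⟨by positivity, h1⟩, by linarith⟩

theorem abs_integral_le_of_frozen_bound {k : ℝ → ℝ → ℝ → ℝ} {K R Λ N V T : ℝ} (hT : 0 < T)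
    (hΛ : 0 ≤ Λ)
    (hc : ∀ m y, Continuous fun t => k t m y)
    (hL : ∀ t m m' y y', |m| ≤ K → |m'| ≤ K → |y| ≤ R → |y'| ≤ R →
      |k t m y - k t m' y'| ≤ Λ * (|m - m'| + |y - y'|))
    (hN : ∀ m y, |m| ≤ K → |y| ≤ R → ∀ a c, 0 ≤ a → a ≤ c → |∫ s in a..c, k s m y| ≤ N)
    {m y : ℝ → ℝ} (hm : ContinuousOn m (Set.Icc 0 T)) (hy : ContinuousOn y (Set.Icc 0 T))
    (hmK : ∀ s ∈ Set.Icc 0 T, |m s| ≤ K) (hyR : ∀ s ∈ Set.Icc 0 T, |y s| ≤ R)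
    (hV : 0 ≤ V)
    (hyV : ∀ s ∈ Set.Icc 0 T, ∀ s' ∈ Set.Icc 0 T, |y s - y s'| ≤ V * |s - s'|)
    {n : ℕ} (hn : 1 ≤ n) {t : ℝ} (ht : t ∈ Set.Icc 0 T) :
    |∫ s in (0:ℝ)..t, k s (m s) (y s)| ≤
      Λ * ((∫ s in (0:ℝ)..T, |m s - m ((⌊s * n / T⌋ : ℝ) * (T / n))|) + V * (T / n) * T) +
        N * (n + 1) := by
  have hn0 : (0:ℝ) < n := by exact_mod_cast hn
  set δ : ℝ := T / n with hδ
  have hδ0 : 0 < δ := by positivity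
  have hnδ : n * δ = T := by rw [hδ]; field_simp
  set ψ : ℝ → ℝ := fun s => |m s - m ((⌊s * n / T⌋ : ℝ) * δ)| with hψ
  have hψi : IntervalIntegrable ψ volume 0 T :=
    intervalIntegrable_abs_sub_comp_floor hT.le hm hmK fun s hs =>
      ⟨(floor_mul_mem_Icc hT hn hs).1.1, (floor_mul_mem_Icc hT hn hs).1.2.trans hs.2⟩
  set φ : ℝ → ℝ := fun s => Λ * (ψ s + V * δ) with hφ
  have hφi : IntervalIntegrable φ volume 0 T := (hψi.add intervalIntegrable_const).const_mul Λ
  have hφ0 : ∀ s, 0 ≤ φ s := fun s => by positivity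
  have hkc : ContinuousOn (fun s => k s (m s) (y s)) (Set.Icc 0 T) :=
    continuousOn_comp_of_lipschitz_box hc hL continuous_id hm hy hmK hyR
  have hsub : ∀ {a c : ℝ}, 0 ≤ a → a ≤ c → c ≤ T → Set.uIcc a c ⊆ Set.uIcc 0 T := by
    intro a c h0 h1 h2
    rw [Set.uIcc_of_le h1, Set.uIcc_of_le hT.le]
    exact Set.Icc_subset_Icc h0 h2
  have hki : ∀ {a c : ℝ}, 0 ≤ a → a ≤ c → c ≤ T →
      IntervalIntegrable (fun s => k s (m s) (y s)) volume a c := fun h0 h1 h2 =>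
    (hkc.intervalIntegrable_of_Icc hT.le).mono_set (hsub h0 h1 h2)
  have hφi' : ∀ {a c : ℝ}, 0 ≤ a → a ≤ c → c ≤ T → IntervalIntegrable φ volume a c :=
    fun h0 h1 h2 => hφi.mono_set (hsub h0 h1 h2)
  have hN0 : 0 ≤ N := (abs_nonneg _).trans
    (hN (m 0) (y 0) (hmK 0 ⟨le_rfl, hT.le⟩) (hyR 0 ⟨le_rfl, hT.le⟩) 0 0 le_rfl le_rfl)
  have hpiece : ∀ (i : ℕ) (u : ℝ), i * δ ≤ u → u ≤ (i + 1) * δ → u ≤ T →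
      |∫ s in (i * δ)..u, k s (m s) (y s)| ≤ (∫ s in (i * δ)..u, φ s) + N := by
    intro i u h1 h2 h3
    have hi0 : 0 ≤ i * δ := by positivity
    have hiT : i * δ ∈ Set.Icc 0 T := ⟨hi0, h1.trans h3⟩
    set m₀ := m (i * δ) with hm₀
    set y₀ := y (i * δ) with hy₀
    have hfz : IntervalIntegrable (fun s => k s m₀ y₀) volume (i * δ) u :=
      (hc m₀ y₀).intervalIntegrable _ _
    have hsplit : ∫ s in (i * δ)..u, k s (m s) (y s) =
        (∫ s in (i * δ)..u, (k s (m s) (y s) - k s m₀ y₀)) + ∫ s in (i * δ)..u, k s m₀ y₀ := by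
      rw [intervalIntegral.integral_sub (hki hi0 h1 h3) hfz]; ring
    rw [hsplit]
    refine (abs_add_le _ _).trans (add_le_add ?_ (hN _ _ (hmK _ hiT) (hyR _ hiT) _ _ hi0 h1))
    refine (intervalIntegral.abs_integral_le_integral_abs h1).trans ?_
    refine intervalIntegral.integral_mono_on_of_le_Ioo h1 ((hki hi0 h1 h3).sub hfz).abs
      (hφi' hi0 h1 h3) fun s hs => ?_
    have hsT : s ∈ Set.Icc 0 T := ⟨hi0.trans hs.1.le, hs.2.le.trans h3⟩
    have hfl : ⌊s * n / T⌋ = (i : ℤ) := by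
      rw [Int.floor_eq_iff, le_div_iff₀ hT, div_lt_iff₀ hT]
      have e1 := mul_lt_mul_of_pos_right hs.1 hn0
      have e2 := mul_lt_mul_of_pos_right (hs.2.trans_le h2) hn0
      push_cast
      constructor <;> nlinarith
    have hφs : φ s = Λ * (|m s - m₀| + V * δ) := by
      simp only [hφ, hψ, hfl, Int.cast_natCast, hm₀]
    rw [hφs]
    refine (hL s _ _ _ _ (hmK _ hsT) (hmK _ hiT) (hyR _ hsT) (hyR _ hiT)).trans ?_
    refine mul_le_mul_of_nonneg_left (add_le_add le_rfl ?_) hΛ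
    refine (hyV s hsT _ hiT).trans (mul_le_mul_of_nonneg_left ?_ hV)
    rw [abs_of_nonneg (by linarith [hs.1])]
    linarith [hs.2]
  have hstep : ∀ (i : ℕ) (u : ℝ), |∫ s in (0:ℝ)..(i * δ), k s (m s) (y s)| ≤
        (∫ s in (0:ℝ)..(i * δ), φ s) + N * i → i * δ ≤ u → u ≤ (i + 1) * δ → u ≤ T →
      |∫ s in (0:ℝ)..u, k s (m s) (y s)| ≤ (∫ s in (0:ℝ)..u, φ s) + N * (i + 1) := by
    intro i u h h1 h2 h3
    have hi0 : 0 ≤ i * δ := by positivity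
    rw [← integral_add_adjacent_intervals (hki le_rfl hi0 (h1.trans h3)) (hki hi0 h1 h3),
      ← integral_add_adjacent_intervals (hφi' le_rfl hi0 (h1.trans h3)) (hφi' hi0 h1 h3)]
    refine (abs_add_le _ _).trans ?_
    linarith [hpiece i u h1 h2 h3]
  have hgrid : ∀ i : ℕ, i ≤ n → |∫ s in (0:ℝ)..(i * δ), k s (m s) (y s)| ≤
      (∫ s in (0:ℝ)..(i * δ), φ s) + N * i := by
    intro i
    induction i with
    | zero => simp
    | succ i ih =>
      intro hi
      have hi' : ((i + 1 : ℕ) : ℝ) ≤ n := by exact_mod_cast hi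
      have h3 : ((i + 1 : ℕ) : ℝ) * δ ≤ T := hnδ ▸ mul_le_mul_of_nonneg_right hi' hδ0.le
      have := hstep i (((i + 1 : ℕ) : ℝ) * δ) (ih (by omega)) (by push_cast; nlinarith)
        (by push_cast; exact le_rfl) h3
      simpa using this
  have hfinal : |∫ s in (0:ℝ)..t, k s (m s) (y s)| ≤ (∫ s in (0:ℝ)..t, φ s) + N * (n + 1) := by
    obtain ⟨ht0, htT⟩ := ht
    have hq : 0 ≤ t / δ := by positivity
    have h1 : (⌊t / δ⌋₊ : ℝ) * δ ≤ t := (le_div_iff₀ hδ0).1 (Nat.floor_le hq)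
    have h2 : t ≤ (⌊t / δ⌋₊ + 1) * δ := ((div_lt_iff₀ hδ0).1 (Nat.lt_floor_add_one _)).le
    have h4 : t / δ ≤ n := by rw [div_le_iff₀ hδ0, hnδ]; exact htT
    have h5 : ⌊t / δ⌋₊ ≤ n := Nat.floor_le_of_le h4
    have h6 : ((⌊t / δ⌋₊ : ℕ) : ℝ) ≤ n := by exact_mod_cast h5
    have := hstep _ t (hgrid _ h5) h1 h2 htT
    refine this.trans (add_le_add le_rfl (mul_le_mul_of_nonneg_left (by linarith) hN0))
  refine hfinal.trans (add_le_add ?_ le_rfl)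
  have hmono : ∫ s in (0:ℝ)..t, φ s ≤ ∫ s in (0:ℝ)..T, φ s :=
    integral_mono_interval le_rfl ht.1 ht.2 (Eventually.of_forall hφ0) hφi
  refine hmono.trans (le_of_eq ?_)
  simp only [hφ]
  rw [intervalIntegral.integral_const_mul, intervalIntegral.integral_add hψi
    intervalIntegrable_const, intervalIntegral.integral_const, smul_eq_mul, sub_zero]
  ring

theorem le_mul_exp_of_le_add_integral {D : ℝ → ℝ} {E Λ T : ℝ} (hE : 0 ≤ E) (hΛ : 0 ≤ Λ)
    (hDc : ContinuousOn D (Set.Icc 0 T))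
    (hD : ∀ t ∈ Set.Icc 0 T, D t ≤ E + Λ * ∫ s in (0:ℝ)..t, D s) {t : ℝ}
    (ht : t ∈ Set.Icc 0 T) : D t ≤ E * Real.exp (Λ * T) := by
  have hT : 0 ≤ T := ht.1.trans ht.2
  set g : ℝ → ℝ := fun s => D (Set.projIcc 0 T hT s) with hg
  have hgc : Continuous g := (continuousOn_iff_continuous_domRestrict.1 hDc).comp continuous_projIcc
  have hgD : ∀ s ∈ Set.Icc 0 T, g s = D s := fun s hs => by
    simp only [hg, Set.projIcc_of_mem hT hs]
  have hint : ∀ s ∈ Set.Icc 0 T, ∫ u in (0:ℝ)..s, g u = ∫ u in (0:ℝ)..s, D u := by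
    intro s hs
    refine intervalIntegral.integral_congr fun u hu => ?_
    rw [Set.uIcc_of_le hs.1] at hu
    exact hgD u ⟨hu.1, hu.2.trans hs.2⟩
  set Φ : ℝ → ℝ := fun s => E + Λ * ∫ u in (0:ℝ)..s, g u with hΦ
  have hΦd : ∀ s, HasDerivAt Φ (Λ * g s) s := fun s =>
    ((hgc.integral_hasStrictDerivAt 0 s).hasDerivAt.const_mul Λ).const_add E
  have hDΦ : ∀ s ∈ Set.Icc 0 T, D s ≤ Φ s := fun s hs => by
    simp only [hΦ, hint s hs]; exact hD s hs
  have key := le_gronwallBound_of_liminf_deriv_right_le (f := Φ) (f' := fun s => Λ * g s)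
    (δ := E) (K := Λ) (ε := 0) (a := 0) (b := T)
    (fun s _ => (hΦd s).continuousAt.continuousWithinAt)
    (fun s _ r hr => (hΦd s).hasDerivWithinAt.liminf_right_slope_le hr)
    (by simp [hΦ])
    (fun s hs => by
      have hs' : s ∈ Set.Icc 0 T := ⟨hs.1, hs.2.le⟩
      rw [add_zero, hgD s hs']
      exact mul_le_mul_of_nonneg_left (hDΦ s hs') hΛ) t ht
  rw [gronwallBound_ε0, sub_zero] at key
  refine (hDΦ t ht).trans (key.trans (mul_le_mul_of_nonneg_left ?_ hE))
  exact Real.exp_le_exp.2 (mul_le_mul_of_nonneg_left ht.2 hΛ)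

end Averaging

section Coefficients

theorem flow_lipschitz_box {σ : ℝ → ℝ} (hσ : Differentiable ℝ σ) {C₁ : ℝ}
    (hC₁ : ∀ x, |deriv σ x| ≤ C₁) {F : ℝ × ℝ → ℝ}
    (hF0 : ∀ x : ℝ, F (0, x) = x)
    (hFr : ∀ r x : ℝ, HasDerivAt (fun r' : ℝ => F (r', x)) (σ (F (r, x))) r)
    (hinj : ∀ r : ℝ, Function.Injective fun x : ℝ => F (r, x)) {K R : ℝ} (hK : 0 ≤ K)
    (hR : 0 ≤ R) :
    ∃ c > 0, ∃ l ≥ 0, (∀ r x, |r| ≤ K → |x| ≤ R → |F (r, x)| ≤ c) ∧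
      ∀ r r' x x', |r| ≤ K → |r'| ≤ K → |x| ≤ R → |x'| ≤ R →
        |F (r, x) - F (r', x')| ≤ l * (|r - r'| + |x - x'|) := by
  have hC₁0 : 0 ≤ C₁ := (abs_nonneg _).trans (hC₁ 0)
  set A := Real.exp (C₁ * K) with hA
  have hA0 : 0 < A := Real.exp_pos _
  have hx : ∀ r x y, |r| ≤ K → |F (r, y) - F (r, x)| ≤ A * |y - x| := by
    intro r x y hr
    refine ((abs_flow_sub_le_and_ge hσ hC₁ hF0 hFr hinj r x y).1).trans ?_
    refine mul_le_mul_of_nonneg_right (Real.exp_le_exp.2 ?_) (abs_nonneg _)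
    exact mul_le_mul_of_nonneg_left hr hC₁0
  have hF0c : Continuous fun u => F (u, 0) :=
    continuous_iff_continuousAt.2 fun u => (hFr u 0).continuousAt
  obtain ⟨c₀, hc₀⟩ := (isCompact_Icc (a := -K) (b := K)).exists_bound_of_continuousOn
    hF0c.continuousOn
  have hc₀0 : 0 ≤ c₀ := (norm_nonneg _).trans (hc₀ 0 ⟨by linarith, hK⟩)
  set c := c₀ + A * R + 1 with hc
  have hFb : ∀ r x, |r| ≤ K → |x| ≤ R → |F (r, x)| ≤ c := by
    intro r x hr hxR
    have h1 := hx r 0 x hr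
    have h2 : |F (r, 0)| ≤ c₀ := hc₀ r (abs_le.1 hr)
    have h3 : |F (r, x)| ≤ |F (r, x) - F (r, 0)| + |F (r, 0)| := by
      simpa using abs_add_le (F (r, x) - F (r, 0)) (F (r, 0))
    rw [sub_zero] at h1
    have h4 := mul_le_mul_of_nonneg_left hxR hA0.le
    linarith
  obtain ⟨s₀, hs₀⟩ := (isCompact_Icc (a := -c) (b := c)).exists_bound_of_continuousOn
    hσ.continuous.continuousOn
  have hcpos : 0 < c := by positivity
  have hs₀0 : 0 ≤ s₀ := (norm_nonneg _).trans (hs₀ 0 ⟨by linarith, hcpos.le⟩)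
  refine ⟨c, hcpos, s₀ + A, by positivity, hFb, fun r r' x x' hr hr' hxR hxR' => ?_⟩
  have h1 : |F (r, x) - F (r', x)| ≤ s₀ * |r - r'| :=
    (convex_Icc (-K) K).norm_image_sub_le_of_norm_hasDerivWithin_le
      (f := fun u => F (u, x)) (f' := fun u => σ (F (u, x)))
      (fun u _ => (hFr u x).hasDerivWithinAt)
      (fun u hu => hs₀ _ (abs_le.1 (hFb u x (abs_le.2 hu) hxR))) (abs_le.1 hr') (abs_le.1 hr)
  have h2 := hx r' x' x hr'
  have h3 := abs_sub_le (F (r, x)) (F (r', x)) (F (r', x'))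
  nlinarith [abs_nonneg (r - r'), abs_nonneg (x - x')]

theorem exp_neg_integral_lipschitz_box {σ : ℝ → ℝ} (hσ : ContDiff ℝ 2 σ) {C₁ C₂ : ℝ}
    (hC₁ : ∀ x, |deriv σ x| ≤ C₁) (hC₂ : ∀ x, |deriv (deriv σ) x| ≤ C₂) {F : ℝ × ℝ → ℝ}
    (hF0 : ∀ x : ℝ, F (0, x) = x)
    (hFr : ∀ r x : ℝ, HasDerivAt (fun r' : ℝ => F (r', x)) (σ (F (r, x))) r)
    (hinj : ∀ r : ℝ, Function.Injective fun x : ℝ => F (r, x)) {K : ℝ} (hK : 0 ≤ K) :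
    (∀ r x, |r| ≤ K →
      |Real.exp (-∫ u in (0:ℝ)..r, deriv σ (F (u, x)))| ≤ Real.exp (C₁ * K)) ∧
    ∃ l ≥ 0, ∀ r r' x x', |r| ≤ K → |r'| ≤ K →
      |Real.exp (-∫ u in (0:ℝ)..r, deriv σ (F (u, x))) -
        Real.exp (-∫ u in (0:ℝ)..r', deriv σ (F (u, x')))| ≤ l * (|r - r'| + |x - x'|) := by
  have hd : Differentiable ℝ σ := hσ.differentiable (by norm_num)
  have hd' : Differentiable ℝ (deriv σ) :=
    (((contDiff_succ_iff_deriv (n := 1)).1 (by simpa using! hσ)).2.2).differentiable (by norm_num)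
  have hC₁0 : 0 ≤ C₁ := (abs_nonneg _).trans (hC₁ 0)
  have hC₂0 : 0 ≤ C₂ := (abs_nonneg _).trans (hC₂ 0)
  have hc : ∀ z, Continuous fun u => deriv σ (F (u, z)) := fun z =>
    hd'.continuous.comp (continuous_iff_continuousAt.2 fun u => (hFr u z).continuousAt)
  set A := Real.exp (C₁ * K) with hA
  have hA0 : 0 < A := Real.exp_pos _
  set S : ℝ → ℝ → ℝ := fun r x => ∫ u in (0:ℝ)..r, deriv σ (F (u, x)) with hS
  have hSr : ∀ r r' x, |S r x - S r' x| ≤ C₁ * |r - r'| := by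
    intro r r' x
    simp only [hS]
    rw [integral_interval_sub_left ((hc x).intervalIntegrable _ _)
      ((hc x).intervalIntegrable _ _)]
    exact norm_integral_le_of_norm_le_const (f := fun u => deriv σ (F (u, x))) (a := r') (b := r)
      fun u _ => hC₁ _
  have hSb : ∀ r x, |r| ≤ K → |S r x| ≤ C₁ * K := by
    intro r x hr
    have h := hSr r 0 x
    have h0 : S 0 x = 0 := integral_same
    rw [h0, sub_zero, sub_zero] at h
    exact h.trans (mul_le_mul_of_nonneg_left hr hC₁0)
  have hSx : ∀ r x x', |r| ≤ K → |S r x - S r x'| ≤ C₂ * (A * |x - x'|) * K := by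
    intro r x x' hr
    simp only [hS]
    rw [← intervalIntegral.integral_sub ((hc x).intervalIntegrable _ _)
      ((hc x').intervalIntegrable _ _)]
    have h := norm_integral_le_of_norm_le_const (a := 0) (b := r) (C := C₂ * (A * |x - x'|))
      (f := fun u => deriv σ (F (u, x)) - deriv σ (F (u, x'))) (fun u hu => by
        have hur : |u| ≤ |r| := by
          simpa using Set.abs_sub_left_of_mem_uIcc (Set.uIoc_subset_uIcc hu)
        refine (convex_univ.norm_image_sub_le_of_norm_deriv_le (f := deriv σ) (C := C₂)
          (fun u _ => hd' u) (fun u _ => hC₂ u) (Set.mem_univ _) (Set.mem_univ _)).trans ?_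
        refine mul_le_mul_of_nonneg_left ?_ hC₂0
        refine ((abs_flow_sub_le_and_ge hd hC₁ hF0 hFr hinj u x' x).1).trans ?_
        refine mul_le_mul_of_nonneg_right (Real.exp_le_exp.2 ?_) (abs_nonneg _)
        exact mul_le_mul_of_nonneg_left (hur.trans hr) hC₁0)
    rw [sub_zero] at h
    exact h.trans (mul_le_mul_of_nonneg_left hr (by positivity))
  have hb : ∀ r x, |r| ≤ K → |Real.exp (-S r x)| ≤ A := by
    intro r x hr
    rw [Real.abs_exp]
    exact Real.exp_le_exp.2 ((neg_le_abs _).trans (hSb r x hr))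
  refine ⟨hb, A * (C₁ + C₂ * A * K), by positivity, fun r r' x x' hr hr' => ?_⟩
  have hexp : |Real.exp (-S r x) - Real.exp (-S r' x')| ≤ A * |-S r x - -S r' x'| :=
    (convex_Iic (C₁ * K)).norm_image_sub_le_of_norm_hasDerivWithin_le
      (f := Real.exp) (f' := Real.exp) (fun u _ => (Real.hasDerivAt_exp u).hasDerivWithinAt)
      (fun u hu => by rw [Real.norm_eq_abs, Real.abs_exp]; exact Real.exp_le_exp.2 hu)
      ((neg_le_abs _).trans (hSb r' x' hr')) ((neg_le_abs _).trans (hSb r x hr))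
  refine hexp.trans ?_
  rw [mul_assoc]
  refine mul_le_mul_of_nonneg_left ?_ hA0.le
  have h1 := hSr r r' x
  have h2 := hSx r' x x' hr'
  have h3 := abs_sub_le (S r x) (S r' x) (S r' x')
  have h4 : |-S r x - -S r' x'| = |S r x - S r' x'| := by rw [← abs_neg]; congr 1; ring
  rw [h4]
  have h5 : 0 ≤ C₁ * |x - x'| := by positivity
  have h6 : 0 ≤ C₂ * A * K * |r - r'| := by positivity
  nlinarith

theorem abs_mul_sub_mul_le {g g' h h' A B l l' d : ℝ} (hg : |g| ≤ A) (hh : |h'| ≤ B)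
    (hgl : |g - g'| ≤ l * d) (hhl : |h - h'| ≤ l' * d) :
    |g * h - g' * h'| ≤ (A * l' + B * l) * d := by
  have h1 : |g * (h - h')| ≤ A * (l' * d) := by
    rw [abs_mul]; exact mul_le_mul hg hhl (abs_nonneg _) ((abs_nonneg _).trans hg)
  have h2 : |(g - g') * h'| ≤ l * d * B := by
    rw [abs_mul]; exact mul_le_mul hgl hh (abs_nonneg _) ((abs_nonneg _).trans hgl)
  have h3 := abs_add_le (g * (h - h')) ((g - g') * h')
  have h4 : g * (h - h') + (g - g') * h' = g * h - g' * h' := by ring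
  rw [h4] at h3
  linarith

theorem time_average_bounds {b : ℝ × ℝ → ℝ} (hbc : Continuous b) {B : ℝ} (hB : ∀ p, |b p| ≤ B)
    {bbar : ℝ → ℝ}
    (hbar : ∀ y : ℝ, Tendsto (fun t : ℝ => (1 / t) * ∫ s in (0:ℝ)..t, b (y, s))
      atTop (nhds (bbar y))) :
    (∀ y, |bbar y| ≤ B) ∧
      ∀ x y C, (∀ t, |b (x, t) - b (y, t)| ≤ C) → |bbar x - bbar y| ≤ C := by
  have hi : ∀ y a c, IntervalIntegrable (fun s => b (y, s)) volume a c := fun y a c =>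
    (hbc.comp (by fun_prop)).intervalIntegrable a c
  have hav : ∀ (f : ℝ → ℝ) (C t : ℝ), 0 < t → (∀ s, |f s| ≤ C) →
      |(1 / t) * ∫ s in (0:ℝ)..t, f s| ≤ C := by
    intro f C t ht hf
    have h := norm_integral_le_of_norm_le_const (a := 0) (b := t) (C := C) (f := f)
      fun u _ => hf u
    rw [sub_zero, abs_of_pos ht, Real.norm_eq_abs] at h
    rw [abs_mul, abs_of_pos (by positivity), one_div, inv_mul_le_iff₀ ht, mul_comm t]
    exact h
  refine ⟨fun y => ?_, fun x y C hC => ?_⟩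
  · refine le_of_tendsto (hbar y).abs ?_
    filter_upwards [eventually_gt_atTop 0] with t ht
    exact hav _ _ t ht fun s => hB _
  · refine le_of_tendsto ((hbar x).sub (hbar y)).abs ?_
    filter_upwards [eventually_gt_atTop 0] with t ht
    rw [← mul_sub, ← intervalIntegral.integral_sub (hi x _ _) (hi y _ _)]
    exact hav _ _ t ht hC

theorem abs_integral_oscillation_le {b : ℝ × ℝ → ℝ} (hbc : Continuous b) {bbar : ℝ → ℝ} {M : ℝ}
    (hG : ∀ y : ℝ, ∀ r : ℝ, 0 ≤ r → |∫ s in (0:ℝ)..r, (b (y, s) - bbar y)| ≤ M) (z : ℝ) {ε : ℝ}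
    (hε : 0 < ε) {a c : ℝ} (ha : 0 ≤ a) (hac : a ≤ c) :
    |∫ s in a..c, (b (z, s / ε) - bbar z)| ≤ 2 * M * ε := by
  have hi : ∀ a c, IntervalIntegrable (fun s => b (z, s) - bbar z) volume a c := fun a c =>
    ((hbc.comp (by fun_prop)).sub continuous_const).intervalIntegrable a c
  rw [intervalIntegral.integral_comp_div (fun s => b (z, s) - bbar z) hε.ne',
    ← integral_interval_sub_left (hi 0 _) (hi 0 _), smul_eq_mul, abs_mul, abs_of_pos hε]
  have h1 := hG z (c / ε) (div_nonneg (ha.trans hac) hε.le)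
  have h2 := hG z (a / ε) (div_nonneg ha hε.le)
  have h3 := abs_sub (∫ s in (0:ℝ)..(c / ε), (b (z, s) - bbar z))
    (∫ s in (0:ℝ)..(a / ε), (b (z, s) - bbar z))
  nlinarith

end Coefficients

section Comparison

theorem abs_sub_le_of_averaged_system {f : ℝ → ℝ → ℝ → ℝ} {fbar : ℝ → ℝ → ℝ}
    {K V Λ N T y₀ ε : ℝ} (hT : 0 < T) (hΛ : 0 ≤ Λ) (hV : 0 ≤ V)
    (hc : ∀ m y, Continuous fun t => f t m y)
    (hfV : ∀ t m y, |m| ≤ K → |f t m y| ≤ V) (hfbarV : ∀ m y, |m| ≤ K → |fbar m y| ≤ V)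
    (hL : ∀ t m m' y y', |m| ≤ K → |m'| ≤ K → |y| ≤ |y₀| + V * T → |y'| ≤ |y₀| + V * T →
      |f t m y - f t m' y'| ≤ Λ * (|m - m'| + |y - y'|))
    (hLbar : ∀ m m' y y', |m| ≤ K → |m'| ≤ K → |y| ≤ |y₀| + V * T → |y'| ≤ |y₀| + V * T →
      |fbar m y - fbar m' y'| ≤ Λ * (|m - m'| + |y - y'|))
    (hN : ∀ m y, |m| ≤ K → |y| ≤ |y₀| + V * T → ∀ a c, 0 ≤ a → a ≤ c →
      |∫ s in a..c, (f (s / ε) m y - fbar m y)| ≤ N)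
    {m Y Ybar : ℝ → ℝ} (hm : ContinuousOn m (Set.Icc 0 T))
    (hmK : ∀ s ∈ Set.Icc 0 T, |m s| ≤ K)
    (hYc : ContinuousOn Y (Set.Icc 0 T)) (hYbarc : ContinuousOn Ybar (Set.Icc 0 T))
    (hY : ∀ t ∈ Set.Icc 0 T, Y t = y₀ + ∫ s in (0:ℝ)..t, f (s / ε) (m s) (Y s))
    (hYbar : ∀ t ∈ Set.Icc 0 T, Ybar t = y₀ + ∫ s in (0:ℝ)..t, fbar (m s) (Ybar s))
    {n : ℕ} (hn : 1 ≤ n) {t : ℝ} (ht : t ∈ Set.Icc 0 T) :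
    |Y t - Ybar t| ≤
      (2 * Λ * ((∫ s in (0:ℝ)..T, |m s - m ((⌊s * n / T⌋ : ℝ) * (T / n))|) + V * (T / n) * T) +
        N * (n + 1)) * Real.exp (Λ * T) := by
  set R := |y₀| + V * T with hR
  have hbound : ∀ (g y : ℝ → ℝ), (∀ s ∈ Set.Icc 0 T, |g s| ≤ V) →
      (∀ t ∈ Set.Icc 0 T, y t = y₀ + ∫ s in (0:ℝ)..t, g s) → ∀ s ∈ Set.Icc 0 T, |y s| ≤ R := by
    intro g y hg hy s hs
    have h := norm_integral_le_of_norm_le_const (a := 0) (b := s) (C := V) (f := g) fun u hu => by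
      rw [Set.uIoc_of_le hs.1] at hu
      exact hg u ⟨hu.1.le, hu.2.trans hs.2⟩
    rw [sub_zero, abs_of_nonneg hs.1, Real.norm_eq_abs] at h
    rw [hy s hs]
    refine (abs_add_le _ _).trans (add_le_add le_rfl (h.trans ?_))
    exact mul_le_mul_of_nonneg_left hs.2 hV
  have hYR : ∀ s ∈ Set.Icc 0 T, |Y s| ≤ R := hbound _ _ (fun s hs => hfV _ _ _ (hmK s hs)) hY
  have hYbarR : ∀ s ∈ Set.Icc 0 T, |Ybar s| ≤ R :=
    hbound _ _ (fun s hs => hfbarV _ _ (hmK s hs)) hYbar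
  have hdiv : Continuous fun s : ℝ => s / ε := by fun_prop
  have hcY : ContinuousOn (fun s => f (s / ε) (m s) (Y s)) (Set.Icc 0 T) :=
    continuousOn_comp_of_lipschitz_box hc hL hdiv hm hYc hmK hYR
  have hcYbar : ContinuousOn (fun s => f (s / ε) (m s) (Ybar s)) (Set.Icc 0 T) :=
    continuousOn_comp_of_lipschitz_box hc hL hdiv hm hYbarc hmK hYbarR
  have hcbar : ContinuousOn (fun s => fbar (m s) (Ybar s)) (Set.Icc 0 T) :=
    continuousOn_comp_of_lipschitz_box (f := fun _ => fbar) (fun _ _ => continuous_const)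
      (fun _ => hLbar) continuous_id hm hYbarc hmK hYbarR
  have hii : ∀ {g : ℝ → ℝ}, ContinuousOn g (Set.Icc 0 T) → ∀ {a c : ℝ}, a ∈ Set.Icc 0 T →
      c ∈ Set.Icc 0 T → IntervalIntegrable g volume a c := fun {g} hg {a c} ha hc =>
    (hg.mono (Set.uIcc_subset_Icc ha hc)).intervalIntegrable
  have h0T : (0:ℝ) ∈ Set.Icc 0 T := ⟨le_rfl, hT.le⟩
  have hYbarV : ∀ s ∈ Set.Icc 0 T, ∀ s' ∈ Set.Icc 0 T, |Ybar s - Ybar s'| ≤ V * |s - s'| := by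
    intro s hs s' hs'
    rw [hYbar s hs, hYbar s' hs', add_sub_add_left_eq_sub,
      integral_interval_sub_left (hii hcbar h0T hs) (hii hcbar h0T hs')]
    refine norm_integral_le_of_norm_le_const (f := fun u => fbar (m u) (Ybar u)) (a := s')
      (b := s) fun u hu => hfbarV _ _ (hmK u ?_)
    exact Set.uIcc_subset_Icc hs' hs (Set.uIoc_subset_uIcc hu)
  set I := ∫ s in (0:ℝ)..T, |m s - m ((⌊s * n / T⌋ : ℝ) * (T / n))| with hI
  set E := 2 * Λ * (I + V * (T / n) * T) + N * (n + 1) with hE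
  have hosc : ∀ u ∈ Set.Icc 0 T,
      |∫ s in (0:ℝ)..u, (f (s / ε) (m s) (Ybar s) - fbar (m s) (Ybar s))| ≤ E := by
    intro u hu
    refine abs_integral_le_of_frozen_bound (k := fun s m y => f (s / ε) m y - fbar m y) hT
      (by positivity) (fun m y => ((hc m y).comp hdiv).sub continuous_const) ?_ hN hm hYbarc hmK
      hYbarR hV hYbarV hn hu
    intro t m m' y y' h1 h2 h3 h4
    have e1 := hL (t / ε) m m' y y' h1 h2 h3 h4
    have e2 := hLbar m m' y y' h1 h2 h3 h4
    have e3 := abs_sub (f (t / ε) m y - f (t / ε) m' y') (fbar m y - fbar m' y')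
    have e4 : f (t / ε) m y - fbar m y - (f (t / ε) m' y' - fbar m' y') =
      f (t / ε) m y - f (t / ε) m' y' - (fbar m y - fbar m' y') := by ring
    rw [e4]
    linarith
  have hE0 : 0 ≤ E := (abs_nonneg _).trans (hosc 0 h0T)
  refine le_mul_exp_of_le_add_integral (D := fun s => |Y s - Ybar s|) hE0 hΛ
    (hYc.sub hYbarc).abs (fun u hu => ?_) ht
  have hdec : Y u - Ybar u = (∫ s in (0:ℝ)..u, (f (s / ε) (m s) (Ybar s) - fbar (m s) (Ybar s))) +
      ∫ s in (0:ℝ)..u, (f (s / ε) (m s) (Y s) - f (s / ε) (m s) (Ybar s)) := by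
    rw [intervalIntegral.integral_sub (hii hcYbar h0T hu) (hii hcbar h0T hu),
      intervalIntegral.integral_sub (hii hcY h0T hu) (hii hcYbar h0T hu), hY u hu, hYbar u hu]
    ring
  simp only [hdec]
  refine (abs_add_le _ _).trans (add_le_add (hosc u hu) ?_)
  refine (intervalIntegral.abs_integral_le_integral_abs hu.1).trans ?_
  rw [← intervalIntegral.integral_const_mul]
  refine intervalIntegral.integral_mono_on hu.1 (hii (hcY.sub hcYbar).abs h0T hu)
    (hii ((hYc.sub hYbarc).abs.const_mul Λ) h0T hu) fun s hs => ?_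
  have hsT : s ∈ Set.Icc 0 T := ⟨hs.1, hs.2.trans hu.2⟩
  have := hL (s / ε) _ _ _ _ (hmK s hsT) (hmK s hsT) (hYR s hsT) (hYbarR s hsT)
  simpa using this

theorem exists_pathwise_averaging_constant
    {σ : ℝ → ℝ} (hσ : ContDiff ℝ 2 σ) {C₁ C₂ : ℝ}
    (hC₁ : ∀ x, |deriv σ x| ≤ C₁) (hC₂ : ∀ x, |deriv (deriv σ) x| ≤ C₂)
    {F H : ℝ × ℝ → ℝ} (hF0 : ∀ x : ℝ, F (0, x) = x)
    (hFr : ∀ r x : ℝ, HasDerivAt (fun r' : ℝ => F (r', x)) (σ (F (r, x))) r)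
    (hH : ∀ r : ℝ, Function.LeftInverse (fun y : ℝ => H (r, y)) (fun x : ℝ => F (r, x)) ∧
      Function.RightInverse (fun y : ℝ => H (r, y)) (fun x : ℝ => F (r, x)))
    {b : ℝ × ℝ → ℝ} (hbc : Continuous b) {B : ℝ} (hB : ∀ p, |b p| ≤ B) {L : ℝ → ℝ}
    (hbL : ∀ c : ℝ, 0 < c → ∀ x y t : ℝ, |x| ≤ c → |y| ≤ c →
      |b (x, t) - b (y, t)| ≤ L c * |x - y|)
    {bbar : ℝ → ℝ}
    (hbar : ∀ y : ℝ, Tendsto (fun t : ℝ => (1 / t) * ∫ s in (0:ℝ)..t, b (y, s))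
      atTop (nhds (bbar y)))
    {M : ℝ} (hG : ∀ y : ℝ, ∀ r : ℝ, 0 ≤ r → |∫ s in (0:ℝ)..r, (b (y, s) - bbar y)| ≤ M)
    {T : ℝ} (hT : 0 < T) (x₀ : ℝ) {K : ℝ} (hK : 0 ≤ K) :
    ∃ C ≥ 0, ∀ m : ℝ → ℝ, ContinuousOn m (Set.Icc 0 T) → (∀ s ∈ Set.Icc 0 T, |m s| ≤ K) →
      ∀ (ε : ℝ) (Y Ybar : ℝ → ℝ), 0 < ε → SolvesAveragingODE F H b m T x₀ ε Y →
      SolvesAveragingODE F H (fun p : ℝ × ℝ => bbar p.1) m T x₀ 1 Ybar →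
      ∀ n : ℕ, 1 ≤ n → ∀ t ∈ Set.Icc 0 T, |F (m t, Y t) - F (m t, Ybar t)| ≤
        C * (1 / n + n * ε +
          ∫ s in (0:ℝ)..T, |m s - m ((⌊s * n / T⌋ : ℝ) * (T / n))|) := by
  have hd : Differentiable ℝ σ := hσ.differentiable (by norm_num)
  have hinj : ∀ r : ℝ, Function.Injective fun x : ℝ => F (r, x) := fun r => (hH r).1.injective
  have hB0 : 0 ≤ B := (abs_nonneg _).trans (hB 0)
  have hM0 : 0 ≤ M := (abs_nonneg _).trans (hG 0 0 le_rfl)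
  have hC₁0 : 0 ≤ C₁ := (abs_nonneg _).trans (hC₁ 0)
  obtain ⟨hgA, lg, hlg0, hgl⟩ := exp_neg_integral_lipschitz_box hσ hC₁ hC₂ hF0 hFr hinj hK
  set A := Real.exp (C₁ * K) with hA
  have hA0 : 0 < A := Real.exp_pos _
  set g : ℝ → ℝ → ℝ := fun r x => Real.exp (-∫ u in (0:ℝ)..r, deriv σ (F (u, x))) with hg
  have hder : ∀ r x, deriv (fun y => H (r, y)) (F (r, x)) = g r x :=
    deriv_flow_inverse hσ hC₁ hC₂ hF0 hFr hH
  obtain ⟨hbbarB, hbbarL⟩ := time_average_bounds hbc hB hbar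
  set V := A * B with hV
  have hV0 : 0 ≤ V := by positivity
  set R := |H (0, x₀)| + V * T with hR
  have hR0 : 0 ≤ R := by positivity
  obtain ⟨c, hc0, lF, hlF0, hFc, hFl⟩ := flow_lipschitz_box hd hC₁ hF0 hFr hinj hK hR0
  set Λ := A * (|L c| * lF) + B * lg with hΛ
  have hΛ0 : 0 ≤ Λ := by positivity
  set f : ℝ → ℝ → ℝ → ℝ := fun t m y => g m y * b (F (m, y), t) with hf
  set fbar : ℝ → ℝ → ℝ := fun m y => g m y * bbar (F (m, y)) with hfbar
  have hbF : ∀ t m m' y y', |m| ≤ K → |m'| ≤ K → |y| ≤ R → |y'| ≤ R →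
      |b (F (m, y), t) - b (F (m', y'), t)| ≤ |L c| * lF * (|m - m'| + |y - y'|) := by
    intro t m m' y y' h1 h2 h3 h4
    refine (hbL c hc0 _ _ t (hFc m y h1 h3) (hFc m' y' h2 h4)).trans ?_
    rw [mul_assoc]
    exact mul_le_mul (le_abs_self _) (hFl m m' y y' h1 h2 h3 h4) (abs_nonneg _) (abs_nonneg _)
  have hmulB : ∀ m y z, |m| ≤ K → |z| ≤ B → |g m y * z| ≤ V := by
    intro m y z hm hz
    rw [abs_mul]
    exact mul_le_mul (hgA m y hm) hz (abs_nonneg _) hA0.le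
  have hcomp := fun (m Y Ybar : ℝ → ℝ) (ε : ℝ) (hε : 0 < ε) =>
    abs_sub_le_of_averaged_system (f := f) (fbar := fbar) (K := K) (V := V) (Λ := Λ)
      (N := A * (2 * M * ε)) (T := T) (y₀ := H (0, x₀)) (ε := ε) (m := m) (Y := Y) (Ybar := Ybar)
      hT hΛ0 hV0
      (fun m y => continuous_const.mul (hbc.comp (by fun_prop)))
      (fun t m y hm => hmulB _ _ _ hm (hB _))
      (fun m y hm => hmulB _ _ _ hm (hbbarB _))
      (fun t m m' y y' h1 h2 h3 h4 => abs_mul_sub_mul_le (hgA m y h1) (hB _)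
        (hgl m m' y y' h1 h2) (hbF t m m' y y' h1 h2 h3 h4))
      (fun m m' y y' h1 h2 h3 h4 => abs_mul_sub_mul_le (hgA m y h1) (hbbarB _)
        (hgl m m' y y' h1 h2) (hbbarL _ _ _ fun t => hbF t m m' y y' h1 h2 h3 h4))
      (fun m y h1 h2 a c ha hac => by
        simp only [hf, hfbar, ← mul_sub]
        rw [intervalIntegral.integral_const_mul, abs_mul]
        exact mul_le_mul (hgA m y h1) (abs_integral_oscillation_le hbc hG _ hε ha hac)
          (abs_nonneg _) hA0.le)
  refine ⟨A * ((2 * Λ + 2 * Λ * V * T * T + 4 * A * M) * Real.exp (Λ * T)), by positivity, ?_⟩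
  intro m hm hmK ε Y Ybar hε hY hYbar n hn t ht
  have h1 := hcomp m Y Ybar ε hε hm hmK hY.1 hYbar.1
    (fun t ht => by rw [hY.2 t ht]; simp only [hder, hf])
    (fun t ht => by rw [hYbar.2 t ht]; simp only [hder, hfbar]) hn ht
  have hn1 : (1:ℝ) ≤ n := by exact_mod_cast hn
  set I := ∫ s in (0:ℝ)..T, |m s - m ((⌊s * n / T⌋ : ℝ) * (T / n))| with hI
  have hI0 : 0 ≤ I := intervalIntegral.integral_nonneg hT.le fun _ _ => abs_nonneg _
  have h2 : |F (m t, Y t) - F (m t, Ybar t)| ≤ A * |Y t - Ybar t| := by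
    refine ((abs_flow_sub_le_and_ge hd hC₁ hF0 hFr hinj (m t) (Ybar t) (Y t)).1).trans ?_
    refine mul_le_mul_of_nonneg_right (Real.exp_le_exp.2 ?_) (abs_nonneg _)
    exact mul_le_mul_of_nonneg_left (hmK t ht) hC₁0
  refine h2.trans ?_
  rw [mul_assoc A]
  refine mul_le_mul_of_nonneg_left (h1.trans ?_) hA0.le
  rw [mul_right_comm (2 * Λ + 2 * Λ * V * T * T + 4 * A * M)]
  refine mul_le_mul_of_nonneg_right ?_ (Real.exp_pos _).le
  have e1 : V * (T / n) * T = V * T * T * (1 / n) := by ring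
  have e2 : A * (2 * M * ε) * (n + 1) ≤ 4 * A * M * (n * ε) := by
    have : 0 ≤ A * M * ε * (n - 1) := by
      have := sub_nonneg.2 hn1
      positivity
    linarith
  have p1 : 0 ≤ 1 / (n:ℝ) := by positivity
  have p2 : 0 ≤ (n:ℝ) * ε := by positivity
  have q1 : 0 ≤ 2 * Λ * (1 / n + n * ε) := by positivity
  have q2 : 0 ≤ 2 * Λ * V * T * T * (n * ε + I) := by positivity
  have q3 : 0 ≤ 4 * A * M * (1 / n + I) := by positivity
  rw [e1]
  linarith

end Comparison

section Probability

theorem tendsto_measure_exists_lt_abs {Ω : Type*} [MeasurableSpace Ω] (P : Measure Ω)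
    [IsFiniteMeasure P] {T : ℝ} {μ : Ω → ℝ → ℝ} (hμc : ∀ ω, ContinuousOn (μ ω) (Set.Icc 0 T))
    (hμmeas : ∀ s : ℝ, Measurable fun ω => μ ω s) :
    Tendsto (fun K : ℕ => P {ω | ∃ t ∈ Set.Icc 0 T, (K : ℝ) < |μ ω t|}) atTop (nhds 0) := by
  obtain ⟨D, hDc, hDd⟩ := TopologicalSpace.exists_countable_dense (Set.Icc (0:ℝ) T)
  have hmeas : ∀ K : ℕ, MeasurableSet {ω | ∃ t ∈ Set.Icc 0 T, (K : ℝ) < |μ ω t|} := by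
    intro K
    have heq : {ω | ∃ t ∈ Set.Icc 0 T, (K : ℝ) < |μ ω t|} =
        ⋃ t ∈ D, {ω | (K : ℝ) < |μ ω t|} := by
      ext ω
      simp only [Set.mem_ofPred_eq, Set.mem_iUnion, exists_prop]
      constructor
      · rintro ⟨t, ht, hKt⟩
        have hcont : Continuous fun s : Set.Icc (0:ℝ) T => |μ ω s| :=
          (continuousOn_iff_continuous_domRestrict.1 (hμc ω)).abs
        obtain ⟨s, hs, hsD⟩ := hDd.exists_mem_open
          (isOpen_lt (continuous_const (y := (K : ℝ))) hcont) ⟨⟨t, ht⟩, hKt⟩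
        exact ⟨s, hs, hsD⟩
      · rintro ⟨t, _, hKt⟩
        exact ⟨t, t.2, hKt⟩
    rw [heq]
    exact MeasurableSet.biUnion hDc fun t _ => measurableSet_lt measurable_const (hμmeas t).abs
  have hempty : ⋂ K : ℕ, {ω | ∃ t ∈ Set.Icc 0 T, (K : ℝ) < |μ ω t|} = ∅ := by
    refine Set.eq_empty_of_forall_notMem fun ω hω => ?_
    obtain ⟨c, hc⟩ := isCompact_Icc.exists_bound_of_continuousOn (hμc ω)
    obtain ⟨K, hK⟩ := exists_nat_ge c
    obtain ⟨t, ht, hlt⟩ := Set.mem_iInter.1 hω K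
    exact absurd (hlt.trans_le ((hc t ht).trans hK)) (lt_irrefl _)
  have h := tendsto_measure_iInter_atTop (μ := P)
    (fun K => (hmeas K).nullMeasurableSet)
    (fun K K' hKK' ω ⟨t, ht, hlt⟩ => ⟨t, ht, lt_of_le_of_lt (Nat.cast_le.2 hKK') hlt⟩)
    ⟨0, measure_ne_top P _⟩
  rwa [hempty, measure_empty] at h

theorem exists_partition_size {e : ℝ} (he : 0 < e) (he1 : e ≤ 1) :
    ∃ n : ℕ, 1 ≤ n ∧ 1 / (n : ℝ) ≤ e ∧ n * e ^ 3 ≤ 2 * e ∧ 1 ≤ e * Real.sqrt n := by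
  have he2 : 0 < e ^ 2 := by positivity
  have hle := Nat.le_ceil (1 / e ^ 2)
  have hlt := Nat.ceil_lt_add_one (a := 1 / e ^ 2) (by positivity)
  set n := ⌈1 / e ^ 2⌉₊ with hn
  have hn0 : (0:ℝ) < n := (by positivity : 0 < 1 / e ^ 2).trans_le hle
  have h1 : 1 ≤ n * e ^ 2 := (div_le_iff₀ he2).1 hle
  refine ⟨n, by exact_mod_cast hn0, ?_, ?_, ?_⟩
  · rw [div_le_iff₀ hn0]
    nlinarith
  · have h2 : n * e ^ 3 ≤ (1 / e ^ 2 + 1) * e ^ 3 := by gcongr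
    have h3 : (1 / e ^ 2 + 1) * e ^ 3 = e + e ^ 3 := by field_simp
    have h4 : e ^ 3 ≤ e := by nlinarith
    linarith
  · have h2 : Real.sqrt (n * e ^ 2) = e * Real.sqrt n := by
      rw [Real.sqrt_mul hn0.le, Real.sqrt_sq he.le, mul_comm]
    rw [← h2]
    exact Real.one_le_sqrt.2 h1

end Probability

/-- Assume that the family of random variables
`ζ_n ω := (n/T)^{1/2} ∫₀^T |μ_s ω − μ_{⌊s n/T⌋ T/n} ω| ds`, `n ≥ 1`, is bounded in
probability.  Then the family `ε^{−1/3} · sup_{t ∈ [0,T]} |X^ε_t ω − X̄_t ω|`,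
`ε ∈ (0, 1]`, is bounded in probability, where `X^ε_t ω = F (μ_t ω, Y^ε_t ω)` and
`X̄_t ω = F (μ_t ω, Ȳ_t ω)`. -/
theorem averaging_rate_in_probability
    (σ : ℝ → ℝ) (hσ : ContDiff ℝ 2 σ)
    (C₁ : ℝ) (hC₁ : ∀ x, |deriv σ x| ≤ C₁)
    (C₂ : ℝ) (hC₂ : ∀ x, |deriv (deriv σ) x| ≤ C₂)
    (F H : ℝ × ℝ → ℝ)
    (hF0 : ∀ x : ℝ, F (0, x) = x)
    (hFr : ∀ r x : ℝ, HasDerivAt (fun r' : ℝ => F (r', x)) (σ (F (r, x))) r)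
    (hH : ∀ r : ℝ, Function.LeftInverse (fun y : ℝ => H (r, y)) (fun x : ℝ => F (r, x)) ∧
      Function.RightInverse (fun y : ℝ => H (r, y)) (fun x : ℝ => F (r, x)))
    (b : ℝ × ℝ → ℝ) (hbc : Continuous b)
    (B : ℝ) (hB : ∀ p, |b p| ≤ B)
    (L : ℝ → ℝ)
    (hbL : ∀ c : ℝ, 0 < c → ∀ x y t : ℝ, |x| ≤ c → |y| ≤ c →
      |b (x, t) - b (y, t)| ≤ L c * |x - y|)
    (bbar : ℝ → ℝ)
    (hbar : ∀ y : ℝ, Tendsto (fun t : ℝ => (1 / t) * ∫ s in (0:ℝ)..t, b (y, s))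
      atTop (nhds (bbar y)))
    (M : ℝ)
    (hG : ∀ y : ℝ, ∀ r : ℝ, 0 ≤ r → |∫ s in (0:ℝ)..r, (b (y, s) - bbar y)| ≤ M)
    (T : ℝ) (hT : 0 < T) (x₀ : ℝ)
    {Ω : Type*} [MeasurableSpace Ω] (P : Measure Ω) [IsProbabilityMeasure P]
    (μ : Ω → ℝ → ℝ)
    (hμc : ∀ ω, ContinuousOn (μ ω) (Set.Icc 0 T))
    (hμ0 : ∀ ω, μ ω 0 = 0)
    (hμmeas : ∀ s : ℝ, Measurable fun ω => μ ω s)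
    (Y : ℝ → Ω → ℝ → ℝ)
    (hY : ∀ ε : ℝ, 0 < ε → ∀ ω, SolvesAveragingODE F H b (μ ω) T x₀ ε (Y ε ω))
    (Ybar : Ω → ℝ → ℝ)
    (hYbar : ∀ ω, SolvesAveragingODE F H (fun p : ℝ × ℝ => bbar p.1) (μ ω) T x₀ 1 (Ybar ω))
    (hζ : BoundedInProbability P
      (fun (n : {n : ℕ // 1 ≤ n}) ω =>
        Real.sqrt ((n : ℝ) / T) *
          ∫ s in (0:ℝ)..T, |μ ω s - μ ω ((⌊s * (n : ℝ) / T⌋ : ℝ) * (T / (n : ℝ)))|))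
    :
    BoundedInProbability P
      (fun (e : {ε : ℝ // 0 < ε ∧ ε ≤ 1}) ω =>
        (e : ℝ) ^ (-(1/3) : ℝ) *
          ⨆ t : Set.Icc (0:ℝ) T, |F (μ ω t, Y (e : ℝ) ω t) - F (μ ω t, Ybar ω t)|) := by
  rw [BoundedInProbability, ENNReal.tendsto_nhds_zero]
  intro η hη
  have hη2 : 0 < η / 2 := ENNReal.half_pos hη.ne'
  obtain ⟨c₁, hc₁, hc₁0⟩ :=
    ((ENNReal.tendsto_nhds_zero.1 hζ (η / 2) hη2).and (eventually_gt_atTop 0)).exists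
  obtain ⟨K, hK⟩ := (ENNReal.tendsto_nhds_zero.1
    (tendsto_measure_exists_lt_abs P hμc hμmeas) (η / 2) hη2).exists
  obtain ⟨C, hC0, hC⟩ := exists_pathwise_averaging_constant hσ hC₁ hC₂ hF0 hFr hH hbc hB hbL hbar
    hG hT x₀ (Nat.cast_nonneg K)
  filter_upwards [eventually_gt_atTop (C * (3 + c₁ * Real.sqrt T))] with c hc
  refine iSup_le fun ⟨ε, hε0, hε1⟩ => ?_
  set e : ℝ := ε ^ (1 / 3 : ℝ) with he
  have he0 : 0 < e := Real.rpow_pos_of_pos hε0 _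
  have he1 : e ≤ 1 := Real.rpow_le_one hε0.le hε1 (by norm_num)
  have he3 : e ^ 3 = ε := by
    rw [he, ← Real.rpow_natCast, ← Real.rpow_mul hε0.le]
    norm_num
  have heinv : ε ^ (-(1 / 3) : ℝ) = e⁻¹ := Real.rpow_neg hε0.le _
  obtain ⟨n, hn, hn1, hn2, hn3⟩ := exists_partition_size he0 he1
  have hn0 : (0:ℝ) < n := by exact_mod_cast hn
  have hsub : {ω | c ≤ |ε ^ (-(1 / 3) : ℝ) *
        (⨆ t : Set.Icc (0:ℝ) T, |F (μ ω t, Y ε ω t) - F (μ ω t, Ybar ω t)|)|} ⊆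
      {ω | ∃ t ∈ Set.Icc 0 T, (K : ℝ) < |μ ω t|} ∪
      {ω | c₁ ≤ |Real.sqrt ((n : ℝ) / T) *
          (∫ s in (0:ℝ)..T, |μ ω s - μ ω ((⌊s * (n : ℝ) / T⌋ : ℝ) * (T / (n : ℝ)))|)|} := by
    intro ω hω
    by_contra hnot
    simp only [Set.mem_union, Set.mem_ofPred_eq, not_or, not_exists, not_and, not_lt,
      not_le] at hnot hω
    obtain ⟨hμK, hζω⟩ := hnot
    have hbd := hC (μ ω) (hμc ω) hμK ε (Y ε ω) (Ybar ω) hε0 (hY ε hε0 ω) (hYbar ω) n hn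
    set I := ∫ s in (0:ℝ)..T, |μ ω s - μ ω ((⌊s * (n : ℝ) / T⌋ : ℝ) * (T / (n : ℝ)))| with hI
    have hI0 : 0 ≤ I := intervalIntegral.integral_nonneg hT.le fun _ _ => abs_nonneg _
    have hsT : 0 < Real.sqrt T := Real.sqrt_pos.2 hT
    have hIle : I ≤ c₁ * Real.sqrt T * e := by
      rw [abs_of_nonneg (by positivity), Real.sqrt_div hn0.le, div_mul_eq_mul_div,
        div_lt_iff₀ hsT] at hζω
      calc I ≤ e * Real.sqrt n * I := le_mul_of_one_le_left hI0 hn3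
        _ = e * (Real.sqrt n * I) := mul_assoc _ _ _
        _ ≤ e * (c₁ * Real.sqrt T) := by gcongr
        _ = c₁ * Real.sqrt T * e := mul_comm _ _
    rw [he3] at hn2
    have hsup : ⨆ t : Set.Icc (0:ℝ) T, |F (μ ω t, Y ε ω t) - F (μ ω t, Ybar ω t)| ≤
        C * ((3 + c₁ * Real.sqrt T) * e) := by
      refine Real.iSup_le (fun t => (hbd t t.2).trans ?_) (by positivity)
      exact mul_le_mul_of_nonneg_left (by linarith) hC0
    have hsup0 : 0 ≤ ⨆ t : Set.Icc (0:ℝ) T, |F (μ ω t, Y ε ω t) - F (μ ω t, Ybar ω t)| :=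
      Real.iSup_nonneg fun _ => abs_nonneg _
    rw [heinv, abs_of_nonneg (by positivity), le_inv_mul_iff₀ he0] at hω
    nlinarith
  calc P {ω | c ≤ |ε ^ (-(1 / 3) : ℝ) *
        (⨆ t : Set.Icc (0:ℝ) T, |F (μ ω t, Y ε ω t) - F (μ ω t, Ybar ω t)|)|}
      ≤ _ := (measure_mono hsub).trans (measure_union_le _ _)
    _ ≤ η / 2 + η / 2 := add_le_add hK ((le_iSup (fun i : {n : ℕ // 1 ≤ n} =>
        P {ω | c₁ ≤ |Real.sqrt ((i : ℝ) / T) *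
          (∫ s in (0:ℝ)..T, |μ ω s - μ ω ((⌊s * (i : ℝ) / T⌋ : ℝ) * (T / (i : ℝ)))|)|})
        ⟨n, hn⟩).trans hc₁)
    _ = η := ENNReal.add_halves η
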